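/- There exists a nonzero algebraic number d ∈ F_{χ₁,χ₂} such that d·S_{χ₁,χ₂}(γ) is an algebraic integer for every γ ∈ Γ₁(q₁q₂); consequently S_{χ₁,χ₂}(Γ₁(q₁q₂)) ⊆ (1/d)·O_{F_{χ₁,χ₂}}, where O_{F_{χ₁,χ₂}} is the ring of algebraic integers of F_{χ₁,χ₂}. -/

import Mathlib

open scoped BigOperators

/-- The sawtooth (first Bernoulli) function `B₁`. -/
noncomputable def sawtooth (x : ℝ) : ℝ :=
  open scoped Classical in
  if ∃ n : ℤ, x = (n : ℝ) then 0 else x - ⌊x⌋ - 1 / 2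

/-- The newform Dedekind sum `S_{χ₁,χ₂}(h,k)`. -/
noncomputable def newformDedekindSum {q₁ q₂ : ℕ} (χ₁ : DirichletCharacter ℂ q₁)
    (χ₂ : DirichletCharacter ℂ q₂) (h k : ℤ) : ℂ :=
  ∑ j ∈ Finset.range k.toNat, ∑ n ∈ Finset.range q₁,
    (starRingEnd ℂ) (χ₂ (j : ZMod q₂)) * (starRingEnd ℂ) (χ₁ (n : ZMod q₁)) *
      (sawtooth ((j : ℝ) / (k : ℝ)) : ℝ) *
      (sawtooth ((n : ℝ) / (q₁ : ℝ) + (h : ℝ) * (j : ℝ) / (k : ℝ)) : ℝ)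

/-- The newform Dedekind sum of a matrix `γ`, via its left column. -/
noncomputable def SGamma {q₁ q₂ : ℕ} (χ₁ : DirichletCharacter ℂ q₁)
    (χ₂ : DirichletCharacter ℂ q₂) (γ : Matrix.SpecialLinearGroup (Fin 2) ℤ) : ℂ :=
  if 0 < (γ : Matrix (Fin 2) (Fin 2) ℤ) 1 0 then
    newformDedekindSum χ₁ χ₂ ((γ : Matrix (Fin 2) (Fin 2) ℤ) 0 0)
      ((γ : Matrix (Fin 2) (Fin 2) ℤ) 1 0)
  else if (γ : Matrix (Fin 2) (Fin 2) ℤ) 1 0 < 0 then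
    newformDedekindSum χ₁ χ₂ (-(γ : Matrix (Fin 2) (Fin 2) ℤ) 0 0)
      (-(γ : Matrix (Fin 2) (Fin 2) ℤ) 1 0)
  else 0

/-- `F_{χ₁,χ₂}`, the smallest subfield of `ℂ` containing all values of `χ₁` and `χ₂`. -/
noncomputable def Ffield {q₁ q₂ : ℕ} (χ₁ : DirichletCharacter ℂ q₁) (χ₂ : DirichletCharacter ℂ q₂) :
    Subfield ℂ :=
  Subfield.closure (Set.range χ₁ ∪ Set.range χ₂)

lemma sawtooth_add_int (x : ℝ) (n : ℤ) : sawtooth (x + n) = sawtooth x := by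
  have h : (∃ m : ℤ, x + n = (m : ℝ)) ↔ ∃ m : ℤ, x = (m : ℝ) := by
    constructor
    · rintro ⟨m, hm⟩
      exact ⟨m - n, by push_cast; linarith⟩
    · rintro ⟨m, hm⟩
      exact ⟨m + n, by push_cast; linarith⟩
  unfold sawtooth
  by_cases hx : ∃ m : ℤ, x = (m : ℝ)
  · rw [if_pos (h.2 hx), if_pos hx]
  · rw [if_neg (mt h.1 hx), if_neg hx, Int.floor_add_intCast]
    push_cast
    ring

lemma sawtooth_of_not_int {x : ℝ} (hx : ¬ ∃ n : ℤ, x = (n : ℝ)) :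
    sawtooth x = x - ⌊x⌋ - 1 / 2 := by
  simp [sawtooth, hx]

lemma exists_rat_eq_sawtooth (r : ℚ) : ∃ s : ℚ, sawtooth (r : ℝ) = (s : ℝ) := by
  by_cases h : ∃ n : ℤ, (r : ℝ) = (n : ℝ)
  · exact ⟨0, by simp [sawtooth, h]⟩
  · refine ⟨r - ⌊r⌋ - 1 / 2, ?_⟩
    rw [sawtooth_of_not_int h]
    push_cast
    simp

/-- If `f` has period `q` and mean zero, the first moment of `f` over `m` periods is `m` times
its first moment over one period. -/
lemma sum_range_mul_id_of_periodic {q : ℕ} (f : ℕ → ℂ) (hf : ∀ j, f (j + q) = f j)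
    (h0 : ∑ r ∈ Finset.range q, f r = 0) (m : ℕ) :
    ∑ j ∈ Finset.range (m * q), f j * j = m * ∑ r ∈ Finset.range q, f r * r := by
  have hper : ∀ m r : ℕ, f (m * q + r) = f r := by
    intro m r
    induction m with
    | zero => simp
    | succ m ih => rw [← ih, ← hf (m * q + r)]; congr 1; ring
  induction m with
  | zero => simp
  | succ m ih =>
    rw [Nat.succ_mul, Finset.sum_range_add, ih]
    have : ∑ x ∈ Finset.range q, f (m * q + x) * ((m * q + x : ℕ) : ℂ)
        = (m * q : ℂ) * ∑ r ∈ Finset.range q, f r + ∑ r ∈ Finset.range q, f r * r := by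
      rw [Finset.mul_sum, ← Finset.sum_add_distrib]
      refine Finset.sum_congr rfl fun x _ => ?_
      rw [hper]
      push_cast
      ring
    rw [this, h0]
    push_cast
    ring

/-- Multiplication by a unit modulo `k` permutes the residues modulo `k`. -/
lemma sum_range_comp_mul_unit {k : ℕ} (hk : 0 < k) {h d : ℤ} (hd : h * d ≡ 1 [ZMOD k])
    (G : ℤ → ℂ) (hG : ∀ a b : ℤ, a ≡ b [ZMOD k] → G a = G b) :
    ∑ j ∈ Finset.range k, G j = ∑ j ∈ Finset.range k, G (d * j) := by
  have hk' : (0 : ℤ) < k := by exact_mod_cast hk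
  have val (x : ℤ) : (((x % k).toNat : ℕ) : ℤ) = x % k :=
    Int.toNat_of_nonneg (Int.emod_nonneg _ hk'.ne')
  have mem (x : ℤ) : (x % k).toNat ∈ Finset.range k := by
    have := Int.emod_lt_of_pos x hk'
    rw [Finset.mem_range]
    zify
    rwa [val]
  have inv {a b : ℤ} (hab : a * b ≡ 1 [ZMOD k]) {j : ℕ} (hj : j ∈ Finset.range k) :
      ((a * (((b * j) % k).toNat : ℕ)) % k).toNat = j := by
    zify
    rw [val, val]
    have h1 : a * ((b * j) % k) ≡ j [ZMOD k] := by
      calc a * ((b * j) % k) ≡ a * (b * j) [ZMOD k] := (Int.mod_modEq _ _).mul_left _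
        _ = a * b * j := by ring
        _ ≡ 1 * j [ZMOD k] := hab.mul_right _
        _ = j := one_mul _
    rw [h1]
    exact Int.emod_eq_of_lt (by positivity) (by exact_mod_cast Finset.mem_range.1 hj)
  refine Finset.sum_nbij' (fun j => ((h * j) % k).toNat) (fun j => ((d * j) % k).toNat)
    (fun _ _ => mem _) (fun _ _ => mem _) (fun j hj => inv (by rwa [mul_comm]) hj)
    (fun j hj => inv hd hj) (fun j _ => hG _ _ ?_)
  rw [val]
  calc (j : ℤ) = 1 * j := (one_mul _).symm
    _ ≡ h * d * j [ZMOD k] := hd.symm.mul_right _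
    _ = d * (h * j) := by ring
    _ ≡ d * ((h * j) % k) [ZMOD k] := (Int.mod_modEq _ _).symm.mul_left _

lemma DirichletCharacter.isIntegral_conj_apply {q : ℕ} [NeZero q] (χ : DirichletCharacter ℂ q)
    (x : ZMod q) : IsIntegral ℤ ((starRingEnd ℂ) (χ x)) := by
  have h : IsIntegral ℤ (χ x) := by
    by_cases hx : IsUnit x
    · obtain ⟨n, hn, hp⟩ := (isOfFinOrder_of_finite hx.unit).exists_pow_eq_one
      refine IsIntegral.of_pow hn ?_
      have : χ x ^ n = 1 := by
        rw [← map_pow, ← hx.unit_spec, ← Units.val_pow_eq_pow_val, hp]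
        simp
      rw [this]
      exact isIntegral_one
    · rw [χ.map_nonunit hx]
      exact isIntegral_zero
  exact h.map ((starRingEnd ℂ).toIntAlgHom)

lemma DirichletCharacter.conj_apply_eq_inv {q : ℕ} [NeZero q] (χ : DirichletCharacter ℂ q)
    (x : ZMod q) : (starRingEnd ℂ) (χ x) = (χ x)⁻¹ := by
  by_cases hx : IsUnit x
  · rw [← hx.unit_spec, Complex.inv_eq_conj (χ.unit_norm_eq_one hx.unit)]
  · simp [χ.map_nonunit hx]

lemma DirichletCharacter.sum_range_conj_eq_zero {q : ℕ} (hq : 1 < q)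
    {χ : DirichletCharacter ℂ q} (hχ : χ.IsPrimitive) :
    ∑ r ∈ Finset.range q, (starRingEnd ℂ) (χ (r : ZMod q)) = 0 := by
  have : NeZero q := ⟨by omega⟩
  have h1 : χ ≠ 1 := by
    rintro rfl
    have h : DirichletCharacter.conductor (1 : DirichletCharacter ℂ q) = q := hχ
    rw [DirichletCharacter.conductor_one] at h
    omega
  have h2 : ∑ r ∈ Finset.range q, χ (r : ZMod q) = ∑ x : ZMod q, χ x := by
    refine Finset.sum_bij' (fun r _ => (r : ZMod q)) (fun x _ => x.val) ?_ ?_ ?_ ?_ ?_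
    · simp
    · intro x _
      exact Finset.mem_range.2 x.val_lt
    · intro r hr
      exact ZMod.val_cast_of_lt (Finset.mem_range.1 hr)
    · simp
    · simp
  rw [← map_sum, h2, MulChar.sum_eq_zero_of_ne_one h1, map_zero]

section Integrality

variable {q₁ q₂ N : ℕ}

lemma DirichletCharacter.apply_intCast_eq_zero_of_dvd (hq₂ : 1 < q₂)
    (χ₂ : DirichletCharacter ℂ q₂) {x : ℤ} (h : (q₂ : ℤ) ∣ x) : χ₂ (x : ZMod q₂) = 0 := by
  have : Fact (1 < q₂) := ⟨hq₂⟩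
  rw [(ZMod.intCast_zmod_eq_zero_iff_dvd x q₂).2 h]
  exact χ₂.map_nonunit not_isUnit_zero

lemma conj_mul_sawtooth (hq₁ : 1 < q₁) (hq₂ : 1 < q₂) (hN : 0 < N)
    (χ₂ : DirichletCharacter ℂ q₂) (x : ℤ) :
    (starRingEnd ℂ) (χ₂ (x : ZMod q₂)) * (sawtooth ((x : ℝ) / ((q₁ * q₂ * N : ℕ) : ℝ)) : ℝ) =
      (starRingEnd ℂ) (χ₂ (x : ZMod q₂)) *
        ((x : ℂ) / ((q₁ * q₂ * N : ℕ) : ℂ) - ⌊(x : ℝ) / ((q₁ * q₂ * N : ℕ) : ℝ)⌋ - 1 / 2) := by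
  by_cases h : ∃ n : ℤ, (x : ℝ) / ((q₁ * q₂ * N : ℕ) : ℝ) = (n : ℝ)
  · obtain ⟨n, hn⟩ := h
    have hk : ((q₁ * q₂ * N : ℕ) : ℝ) ≠ 0 := by
      have : 0 < q₁ * q₂ * N := by positivity
      exact_mod_cast this.ne'
    rw [div_eq_iff hk] at hn
    have hx : x = n * (q₁ * q₂ * N : ℕ) := by exact_mod_cast hn
    rw [χ₂.apply_intCast_eq_zero_of_dvd hq₂ ⟨n * q₁ * N, by rw [hx]; push_cast; ring⟩]
    simp
  · rw [sawtooth_of_not_int h]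
    push_cast
    ring

/-- Twisted sums of the sawtooth function over initial segments made of whole blocks of length
`k / q₁`, where `k = q₁ q₂ N`, have bounded denominators. -/
lemma isIntegral_partial_sum (hq₁ : 1 < q₁) (hq₂ : 1 < q₂) (hN : 0 < N)
    {χ₂ : DirichletCharacter ℂ q₂} (hχ₂ : χ₂.IsPrimitive) (d : ℤ) (m : ℕ) :
    IsIntegral ℤ ((2 * q₁ * q₂ : ℂ) * ∑ j ∈ Finset.range (m * N * q₂),
      (starRingEnd ℂ) (χ₂ ((d * j : ℤ) : ZMod q₂)) *
        (sawtooth (((d * j : ℤ) : ℝ) / ((q₁ * q₂ * N : ℕ) : ℝ)) : ℝ)) := by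
  have : NeZero q₂ := ⟨by omega⟩
  have hint (n : ℤ) : IsIntegral ℤ (n : ℂ) := isIntegral_algebraMap (R := ℤ) (x := n)
  have hnat (n : ℕ) : IsIntegral ℤ (n : ℂ) := by exact_mod_cast hint n
  have hψ := χ₂.isIntegral_conj_apply
  set ψ : ℕ → ℂ := fun j => (starRingEnd ℂ) (χ₂ (j : ZMod q₂))
  have hmom : ∑ j ∈ Finset.range (m * N * q₂), ψ j * j =
      ((m * N : ℕ) : ℂ) * ∑ r ∈ Finset.range q₂, ψ r * r :=
    sum_range_mul_id_of_periodic ψ (by simp [ψ])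
      (DirichletCharacter.sum_range_conj_eq_zero hq₂ hχ₂) _
  have hmul (j : ℕ) : (starRingEnd ℂ) (χ₂ ((d * j : ℤ) : ZMod q₂)) =
      (starRingEnd ℂ) (χ₂ (d : ZMod q₂)) * ψ j := by
    simp [ψ]
  have hk : (q₁ : ℂ) ≠ 0 ∧ (q₂ : ℂ) ≠ 0 ∧ (N : ℂ) ≠ 0 := by
    refine ⟨?_, ?_, ?_⟩ <;> norm_cast <;> omega
  obtain ⟨h1, h2, h3⟩ := hk
  have key : (2 * q₁ * q₂ : ℂ) * ∑ j ∈ Finset.range (m * N * q₂),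
      (starRingEnd ℂ) (χ₂ ((d * j : ℤ) : ZMod q₂)) *
        (sawtooth (((d * j : ℤ) : ℝ) / ((q₁ * q₂ * N : ℕ) : ℝ)) : ℝ) =
      (starRingEnd ℂ) (χ₂ (d : ZMod q₂)) * ((2 * d * m : ℤ) : ℂ) *
          (∑ r ∈ Finset.range q₂, ψ r * r) -
        ((q₁ * q₂ : ℕ) : ℂ) * ∑ j ∈ Finset.range (m * N * q₂),
          (starRingEnd ℂ) (χ₂ ((d * j : ℤ) : ZMod q₂)) *
            ((2 * ⌊((d * j : ℤ) : ℝ) / ((q₁ * q₂ * N : ℕ) : ℝ)⌋ + 1 : ℤ) : ℂ) := by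
    have e : (starRingEnd ℂ) (χ₂ (d : ZMod q₂)) * ((2 * d * m : ℤ) : ℂ) *
          (∑ r ∈ Finset.range q₂, ψ r * r) =
        (starRingEnd ℂ) (χ₂ (d : ZMod q₂)) * (2 * d / N) *
          ∑ j ∈ Finset.range (m * N * q₂), ψ j * j := by
      rw [hmom]
      push_cast
      field_simp
    rw [e, Finset.mul_sum, Finset.mul_sum, Finset.mul_sum, ← Finset.sum_sub_distrib]
    refine Finset.sum_congr rfl fun j _ => ?_
    rw [conj_mul_sawtooth hq₁ hq₂ hN, hmul]
    push_cast
    field_simp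
    ring
  rw [key]
  refine (((hψ _).mul (hint _)).mul ?_).sub ((hnat _).mul ?_)
  · exact IsIntegral.sum _ fun r _ => (hψ _).mul (hnat _)
  · exact IsIntegral.sum _ fun j _ => (hψ _).mul (hint _)

lemma floor_add_div_eq_ite {k n j : ℕ} (hk : k = q₁ * q₂ * N) (hk0 : 0 < k)
    (hn : n < q₁) (hj : j < k) :
    ⌊(n : ℝ) / (q₁ : ℝ) + (j : ℝ) / (k : ℝ)⌋ = if j < (q₁ - n) * N * q₂ then 0 else 1 := by
  have hq : (0 : ℝ) < q₁ := by exact_mod_cast (by omega : 0 < q₁)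
  have hkR : (0 : ℝ) < k := by exact_mod_cast hk0
  have hval : (n : ℝ) / (q₁ : ℝ) + (j : ℝ) / (k : ℝ) = (n * N * q₂ + j) / k := by
    have h : (k : ℝ) = q₁ * q₂ * N := by rw [hk]; push_cast; ring
    have h' := hkR.ne'
    rw [h] at h' ⊢
    have h2 : (q₂ : ℝ) ≠ 0 := by rintro h2; simp [h2] at h'
    have h3 : (N : ℝ) ≠ 0 := by rintro h3; simp [h3] at h'
    field_simp
  have hsplit : (q₁ - n) * N * q₂ + n * N * q₂ = k := by
    rw [hk]
    obtain ⟨t, rfl⟩ := Nat.exists_eq_add_of_lt hn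
    rw [show n + t + 1 - n = t + 1 by omega]
    ring
  rw [hval, Int.floor_eq_iff]
  split_ifs with h
  · have : n * N * q₂ + j < k := by omega
    have h' : (n * N * q₂ + j : ℝ) < k := by exact_mod_cast this
    refine ⟨by push_cast; positivity, ?_⟩
    push_cast
    rw [zero_add, div_lt_one hkR]
    exact h'
  · have h1 : k ≤ n * N * q₂ + j := by omega
    have h2 : n * N * q₂ + j < 2 * k := by
      have : n * N * q₂ ≤ k := by omega
      omega
    have h1' : (k : ℝ) ≤ (n * N * q₂ + j : ℝ) := by exact_mod_cast h1
    have h2' : (n * N * q₂ + j : ℝ) < 2 * k := by exact_mod_cast h2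
    push_cast
    rw [le_div_iff₀ hkR, div_lt_iff₀ hkR]
    constructor <;> linarith

lemma conj_mul_sawtooth_add (hq₁ : 1 < q₁) (hq₂ : 1 < q₂) (hN : 0 < N)
    (χ₂ : DirichletCharacter ℂ q₂) (d : ℤ) {n j : ℕ} (hn : n < q₁) (hj : j < q₁ * q₂ * N) :
    (starRingEnd ℂ) (χ₂ ((d * j : ℤ) : ZMod q₂)) *
        (sawtooth ((n : ℝ) / (q₁ : ℝ) + (j : ℝ) / ((q₁ * q₂ * N : ℕ) : ℝ)) : ℝ) =
      (starRingEnd ℂ) (χ₂ ((d * j : ℤ) : ZMod q₂)) *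
        ((n : ℂ) / q₁ + ((j : ℂ) / ((q₁ * q₂ * N : ℕ) : ℂ) - 3 / 2) +
          if j < (q₁ - n) * N * q₂ then 1 else 0) := by
  have hk0 : 0 < q₁ * q₂ * N := by positivity
  by_cases h : ∃ z : ℤ, (n : ℝ) / (q₁ : ℝ) + (j : ℝ) / ((q₁ * q₂ * N : ℕ) : ℝ) = (z : ℝ)
  · obtain ⟨z, hz⟩ := h
    have h1 : (q₁ : ℝ) ≠ 0 ∧ (q₂ : ℝ) ≠ 0 ∧ (N : ℝ) ≠ 0 := by
      refine ⟨?_, ?_, ?_⟩ <;> norm_cast <;> omega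
    obtain ⟨h1, h2, h3⟩ := h1
    have hz' : (j : ℝ) = q₂ * (z * q₁ * N - n * N) := by
      push_cast at hz
      field_simp at hz
      linarith
    have hj' : (j : ℤ) = q₂ * (z * q₁ * N - n * N) := by exact_mod_cast hz'
    rw [χ₂.apply_intCast_eq_zero_of_dvd hq₂ (Dvd.dvd.mul_left ⟨_, hj'⟩ d)]
    simp
  · rw [sawtooth_of_not_int h, floor_add_div_eq_ite rfl hk0 hn hj]
    congr 1
    split_ifs <;> push_cast <;> ring

lemma isIntegral_newformDedekindSum (hq₁ : 1 < q₁) (hq₂ : 1 < q₂) (hN : 0 < N)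
    {χ₁ : DirichletCharacter ℂ q₁} {χ₂ : DirichletCharacter ℂ q₂}
    (hχ₁ : χ₁.IsPrimitive) (hχ₂ : χ₂.IsPrimitive) {h d : ℤ}
    (hd : h * d ≡ 1 [ZMOD (q₁ * q₂ * N : ℕ)]) :
    IsIntegral ℤ ((2 * q₁ ^ 2 * q₂ : ℂ) *
      newformDedekindSum χ₁ χ₂ h ((q₁ * q₂ * N : ℕ) : ℤ)) := by
  have : NeZero q₁ := ⟨by omega⟩
  have hnat (n : ℕ) : IsIntegral ℤ (n : ℂ) := by
    exact_mod_cast isIntegral_algebraMap (R := ℤ) (A := ℂ) (x := (n : ℤ))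
  have hk0 : 0 < q₁ * q₂ * N := by positivity
  have hkR : ((q₁ * q₂ * N : ℕ) : ℝ) ≠ 0 := by exact_mod_cast hk0.ne'
  have hq : (q₁ : ℂ) ≠ 0 := by exact_mod_cast (by omega : q₁ ≠ 0)
  set φ : ℕ → ℂ := fun n => (starRingEnd ℂ) (χ₁ (n : ZMod q₁))
  set u : ℕ → ℂ := fun j => (starRingEnd ℂ) (χ₂ ((d * j : ℤ) : ZMod q₂)) *
        (sawtooth (((d * j : ℤ) : ℝ) / ((q₁ * q₂ * N : ℕ) : ℝ)) : ℝ) with hu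
  have hφ0 : ∑ n ∈ Finset.range q₁, φ n = 0 :=
    DirichletCharacter.sum_range_conj_eq_zero hq₁ hχ₁
  have hP (m : ℕ) : IsIntegral ℤ
      ((2 * q₁ * q₂ : ℂ) * ∑ j ∈ Finset.range (m * N * q₂), u j) :=
    isIntegral_partial_sum hq₁ hq₂ hN hχ₂ d m
  have hS : newformDedekindSum χ₁ χ₂ h ((q₁ * q₂ * N : ℕ) : ℤ) =
      ∑ j ∈ Finset.range (q₁ * q₂ * N), ∑ n ∈ Finset.range q₁, φ n * (u j *
        (sawtooth ((n : ℝ) / (q₁ : ℝ) + (j : ℝ) / ((q₁ * q₂ * N : ℕ) : ℝ)) : ℝ)) := by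
    have hG := sum_range_comp_mul_unit hk0 hd (fun j : ℤ => ∑ n ∈ Finset.range q₁,
      (starRingEnd ℂ) (χ₂ (j : ZMod q₂)) * φ n *
      (sawtooth ((j : ℝ) / ((q₁ * q₂ * N : ℕ) : ℝ)) : ℝ) *
      (sawtooth ((n : ℝ) / (q₁ : ℝ) + (h : ℝ) * (j : ℝ) / ((q₁ * q₂ * N : ℕ) : ℝ)) : ℝ)) ?_
    · unfold newformDedekindSum
      rw [Int.toNat_natCast]
      refine Eq.trans ?_ (hG.trans ?_)
      · simp [φ]
      · refine Finset.sum_congr rfl fun j _ => Finset.sum_congr rfl fun n _ => ?_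
        obtain ⟨t, ht⟩ := hd.symm.dvd
        have ht' : (h : ℝ) * d = 1 + ((q₁ * q₂ * N : ℕ) : ℝ) * t := by
          have : h * d = 1 + ((q₁ * q₂ * N : ℕ) : ℤ) * t := by linarith
          exact_mod_cast this
        have e : (n : ℝ) / (q₁ : ℝ) + (h : ℝ) * ((d * j : ℤ) : ℝ) / ((q₁ * q₂ * N : ℕ) : ℝ) =
            (n : ℝ) / (q₁ : ℝ) + (j : ℝ) / ((q₁ * q₂ * N : ℕ) : ℝ) + ((t * j : ℤ) : ℝ) := by
          have : (h : ℝ) * ((d * j : ℤ) : ℝ) =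
              j + ((q₁ * q₂ * N : ℕ) : ℝ) * ((t * j : ℤ) : ℝ) := by
            push_cast at ht' ⊢
            linear_combination (j : ℝ) * ht'
          rw [this, add_div, mul_div_cancel_left₀ _ hkR]
          ring
        rw [e, sawtooth_add_int]
        simp only [hu]
        ring
    · intro a b hab
      obtain ⟨t, ht⟩ := hab.dvd
      have hb : b = a + ((q₁ * q₂ * N : ℕ) : ℤ) * t := by linarith
      have hbR : (b : ℝ) = a + ((q₁ * q₂ * N : ℕ) : ℝ) * t := by exact_mod_cast hb
      have hχ : (a : ZMod q₂) = (b : ZMod q₂) := by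
        rw [hb]
        simp
      refine Finset.sum_congr rfl fun n _ => ?_
      have e1 : (b : ℝ) / ((q₁ * q₂ * N : ℕ) : ℝ) = a / ((q₁ * q₂ * N : ℕ) : ℝ) + t := by
        rw [hbR, add_div, mul_div_cancel_left₀ _ hkR]
      have e2 : (n : ℝ) / (q₁ : ℝ) + (h : ℝ) * (b : ℝ) / ((q₁ * q₂ * N : ℕ) : ℝ) =
          (n : ℝ) / (q₁ : ℝ) + (h : ℝ) * (a : ℝ) / ((q₁ * q₂ * N : ℕ) : ℝ) +
            ((h * t : ℤ) : ℝ) := by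
        rw [mul_div_assoc, e1]
        push_cast
        ring
      rw [e2, e1, sawtooth_add_int, sawtooth_add_int, hχ]
  have hsum : newformDedekindSum χ₁ χ₂ h ((q₁ * q₂ * N : ℕ) : ℤ) =
      (∑ n ∈ Finset.range q₁, φ n * n) / q₁ * (∑ j ∈ Finset.range (q₁ * N * q₂), u j) +
        ∑ n ∈ Finset.range q₁, φ n * ∑ j ∈ Finset.range ((q₁ - n) * N * q₂), u j := by
    have hterm : ∀ j ∈ Finset.range (q₁ * q₂ * N), ∑ n ∈ Finset.range q₁, φ n * (u j *
        (sawtooth ((n : ℝ) / (q₁ : ℝ) + (j : ℝ) / ((q₁ * q₂ * N : ℕ) : ℝ)) : ℝ)) =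
        (∑ n ∈ Finset.range q₁, φ n * n) / q₁ * u j +
          ∑ n ∈ Finset.range q₁, φ n * (if j < (q₁ - n) * N * q₂ then u j else 0) := by
      intro j hj
      have e : (∑ n ∈ Finset.range q₁, φ n * n) / q₁ * u j =
          (∑ n ∈ Finset.range q₁, φ n * n) / q₁ * u j +
          ((j : ℂ) / ((q₁ * q₂ * N : ℕ) : ℂ) - 3 / 2) * u j * ∑ n ∈ Finset.range q₁, φ n := by
        rw [hφ0]
        ring
      rw [e, Finset.sum_div, Finset.sum_mul, Finset.mul_sum, ← Finset.sum_add_distrib,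
        ← Finset.sum_add_distrib]
      refine Finset.sum_congr rfl fun n hn => ?_
      have := conj_mul_sawtooth_add hq₁ hq₂ hN χ₂ d (Finset.mem_range.1 hn)
        (Finset.mem_range.1 hj)
      simp only [hu]
      rw [mul_right_comm ((starRingEnd ℂ) _), this]
      split_ifs <;> ring
    rw [hS, Finset.sum_congr rfl hterm, Finset.sum_add_distrib, ← Finset.mul_sum,
      Finset.sum_comm]
    congr 1
    · rw [mul_right_comm q₁ q₂ N]
    · refine Finset.sum_congr rfl fun n _ => ?_
      rw [← Finset.mul_sum, ← Finset.sum_filter]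
      congr 2
      ext j
      have hle : (q₁ - n) * N * q₂ ≤ q₁ * q₂ * N := by
        rw [mul_right_comm q₁ q₂ N]
        gcongr
        omega
      simp only [Finset.mem_filter, Finset.mem_range]
      omega
  have key : (2 * q₁ ^ 2 * q₂ : ℂ) * newformDedekindSum χ₁ χ₂ h ((q₁ * q₂ * N : ℕ) : ℤ) =
      (∑ n ∈ Finset.range q₁, φ n * n) *
          ((2 * q₁ * q₂ : ℂ) * ∑ j ∈ Finset.range (q₁ * N * q₂), u j) +
        q₁ * ∑ n ∈ Finset.range q₁, φ n *
          ((2 * q₁ * q₂ : ℂ) * ∑ j ∈ Finset.range ((q₁ - n) * N * q₂), u j) := by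
    rw [hsum]
    simp_rw [mul_left_comm (φ _) (2 * q₁ * q₂ : ℂ), ← Finset.mul_sum]
    field_simp
  rw [key]
  have hφi (n : ℕ) : IsIntegral ℤ (φ n) := χ₁.isIntegral_conj_apply _
  exact ((IsIntegral.sum _ fun n _ => (hφi n).mul (hnat n)).mul (hP _)).add
    ((hnat _).mul (IsIntegral.sum _ fun n _ => (hφi n).mul (hP _)))

lemma newformDedekindSum_mem_Ffield [NeZero q₁] [NeZero q₂]
    (χ₁ : DirichletCharacter ℂ q₁) (χ₂ : DirichletCharacter ℂ q₂) (h k : ℤ) :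
    newformDedekindSum χ₁ χ₂ h k ∈ Ffield χ₁ χ₂ := by
  have hsaw (r : ℚ) : ((sawtooth (r : ℝ) : ℝ) : ℂ) ∈ Ffield χ₁ χ₂ := by
    obtain ⟨s, hs⟩ := exists_rat_eq_sawtooth r
    rw [hs]
    push_cast
    exact SubfieldClass.ratCast_mem _ s
  refine Subfield.sum_mem _ fun j _ => Subfield.sum_mem _ fun n _ => ?_
  refine mul_mem (mul_mem (mul_mem ?_ ?_) ?_) ?_
  · rw [χ₂.conj_apply_eq_inv]
    exact inv_mem (Subfield.subset_closure (Or.inr ⟨_, rfl⟩))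
  · rw [χ₁.conj_apply_eq_inv]
    exact inv_mem (Subfield.subset_closure (Or.inl ⟨_, rfl⟩))
  · have := hsaw (j / k)
    push_cast at this
    exact this
  · have := hsaw (n / q₁ + h * j / k)
    push_cast at this
    exact this

end Integrality

/-- There is a nonzero `d ∈ F_{χ₁,χ₂}` such that `d · S_{χ₁,χ₂}(γ)` is an algebraic integer
(lying in `F_{χ₁,χ₂}`) for every `γ ∈ Γ₁(q₁q₂)`; equivalently,
`S_{χ₁,χ₂}(Γ₁(q₁q₂)) ⊆ (1/d) O_{F_{χ₁,χ₂}}`. -/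
theorem exists_denominator_clearing {q₁ q₂ : ℕ} (hq₁ : 1 < q₁) (hq₂ : 1 < q₂)
    (χ₁ : DirichletCharacter ℂ q₁) (χ₂ : DirichletCharacter ℂ q₂)
    (hχ₁ : DirichletCharacter.IsPrimitive χ₁) (hχ₂ : DirichletCharacter.IsPrimitive χ₂)
    (hpar : χ₁ (-1) * χ₂ (-1) = 1) :
    ∃ d : ℂ, d ∈ Ffield χ₁ χ₂ ∧ d ≠ 0 ∧
      ∀ γ ∈ CongruenceSubgroup.Gamma1 (q₁ * q₂),
        d * SGamma χ₁ χ₂ γ ∈ Ffield χ₁ χ₂ ∧ IsIntegral ℤ (d * SGamma χ₁ χ₂ γ) := by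
  have : NeZero q₁ := ⟨by omega⟩
  have : NeZero q₂ := ⟨by omega⟩
  have hd : (2 * q₁ ^ 2 * q₂ : ℂ) ∈ Ffield χ₁ χ₂ := by
    have := natCast_mem (Ffield χ₁ χ₂) (2 * q₁ ^ 2 * q₂)
    exact_mod_cast this
  refine ⟨2 * q₁ ^ 2 * q₂, hd, by simp [NeZero.ne], fun γ hγ => ?_⟩
  obtain ⟨-, -, hc⟩ := CongruenceSubgroup.Gamma1_mem _ _ |>.1 hγ
  rw [ZMod.intCast_zmod_eq_zero_iff_dvd] at hc
  have hdet := Matrix.det_fin_two γ.1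
  rw [γ.2] at hdet
  have pos {h d k : ℤ} (hk : 0 < k) (hdvd : ((q₁ * q₂ : ℕ) : ℤ) ∣ k)
      (hinv : h * d ≡ 1 [ZMOD k]) :
      IsIntegral ℤ ((2 * q₁ ^ 2 * q₂ : ℂ) * newformDedekindSum χ₁ χ₂ h k) := by
    lift k to ℕ using hk.le
    obtain ⟨N, rfl⟩ := Int.natCast_dvd_natCast.1 hdvd
    exact isIntegral_newformDedekindSum hq₁ hq₂
      (Nat.pos_of_ne_zero fun h0 => by simp [h0] at hk) hχ₁ hχ₂ hinv
  unfold SGamma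
  split_ifs with h1 h2
  · refine ⟨mul_mem hd (newformDedekindSum_mem_Ffield _ _ _ _), pos (d := γ.1 1 1) h1 hc ?_⟩
    exact (Int.modEq_iff_dvd.2 ⟨γ.1 0 1, by linarith⟩).symm
  · refine ⟨mul_mem hd (newformDedekindSum_mem_Ffield _ _ _ _),
      pos (d := -γ.1 1 1) (by linarith) hc.neg_right ?_⟩
    exact (Int.modEq_iff_dvd.2 ⟨-γ.1 0 1, by linarith⟩).symm
  · simp [zero_mem, isIntegral_zero]
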